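/- arXiv:2310.18388 — 7 statements merged into one kernel-verified Lean document; each statement's English description precedes it below -/
import Mathlib

section
/- The covered-demand set function g is submodular (has diminishing returns): for any subsets S ⊆ S̃ of the ground set V = I × J × T and any element v = (i,j,t) ∈ V with v ∉ S̃, it holds that g(S ∪ {v}) − g(S) ≥ g(S̃ ∪ {v}) − g(S̃). -/
open Finset

/-- Covered demand of a schedule `S ⊆ I × J × T` :
`g(S) = Σ_{j,k,t} d j k t * (1 - Π_i Π_{τ ≥ t} (1 - a i k * 1[(i,j,τ) ∈ S]))`. -/
noncomputable def coveredDemand {I J K T : Type*} [Fintype I] [Fintype J] [Fintype K]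
    [Fintype T] [LinearOrder T] [DecidableEq I] [DecidableEq J]
    (a : I → K → ℝ) (d : J → K → T → ℝ) (S : Finset (I × J × T)) : ℝ :=
  ∑ j, ∑ k, ∑ t, d j k t *
    (1 - ∏ i, ∏ τ ∈ Finset.univ.filter (fun τ => t ≤ τ),
        (1 - a i k * (if (i, j, τ) ∈ S then (1 : ℝ) else 0)))

/-- For 0/1 availabilities, the indicator that the demand for product `k` at station `j` and
timeslot `t` is not covered by the schedule `S`. -/
noncomputable def uncovered {I J K T : Type*} [Fintype I] [Fintype T] [LinearOrder T]
    [DecidableEq I] [DecidableEq J] (a : I → K → ℝ) (j : J) (k : K) (t : T)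
    (S : Finset (I × J × T)) : ℝ :=
  ∏ i, ∏ τ ∈ Finset.univ.filter (fun τ => t ≤ τ),
    (1 - a i k * (if (i, j, τ) ∈ S then (1 : ℝ) else 0))

theorem one_sub_mul_ite_nonneg {x : ℝ} (hx : x ≤ 1) (p : Prop) [Decidable p] :
    0 ≤ 1 - x * (if p then (1 : ℝ) else 0) := by
  split_ifs <;> simp [hx]

section Uncovered

variable {I J K T : Type*} [Fintype I] [Fintype T] [LinearOrder T]
  [DecidableEq I] [DecidableEq J] {a : I → K → ℝ}

theorem uncovered_insert (a : I → K → ℝ) (j : J) (k : K) (t : T)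
    {S : Finset (I × J × T)} {v : I × J × T} (hv : v ∉ S) :
    uncovered a j k t (insert v S) = uncovered a j k t {v} * uncovered a j k t S := by
  simp only [uncovered, ← Finset.prod_mul_distrib]
  refine Finset.prod_congr rfl fun i _ => Finset.prod_congr rfl fun τ _ => ?_
  by_cases h : (i, j, τ) = v
  · simp [h, hv]
  · simp [h]

theorem uncovered_antitone (ha₀ : ∀ i k, 0 ≤ a i k) (ha₁ : ∀ i k, a i k ≤ 1)
    (j : J) (k : K) (t : T) : Antitone (uncovered a j k t) := by
  intro S S' h
  refine Finset.prod_le_prod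
    (fun i _ => Finset.prod_nonneg fun τ _ => one_sub_mul_ite_nonneg (ha₁ i k) _)
    fun i _ => Finset.prod_le_prod (fun τ _ => one_sub_mul_ite_nonneg (ha₁ i k) _) fun τ _ => ?_
  have hle : (if (i, j, τ) ∈ S then (1 : ℝ) else 0) ≤ if (i, j, τ) ∈ S' then 1 else 0 := by
    by_cases hS : (i, j, τ) ∈ S
    · simp [hS, h hS]
    · simp only [hS, if_false]
      split_ifs <;> norm_num
  exact sub_le_sub_left (mul_le_mul_of_nonneg_left hle (ha₀ i k)) 1

theorem uncovered_le_one (ha₀ : ∀ i k, 0 ≤ a i k) (ha₁ : ∀ i k, a i k ≤ 1)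
    (j : J) (k : K) (t : T) (S : Finset (I × J × T)) : uncovered a j k t S ≤ 1 := by
  simpa [uncovered] using uncovered_antitone ha₀ ha₁ j k t (Finset.empty_subset S)

end Uncovered

/-- **Submodularity (diminishing returns) of the covered-demand set function.**
For subsets `S ⊆ S'` of the ground set `I × J × T` and an element `v ∉ S'`,
the marginal gain of adding `v` to `S` is at least the marginal gain of adding it to `S'`. -/
theorem coveredDemand_submodular
    {I J K T : Type*} [Fintype I] [Fintype J] [Fintype K] [Fintype T] [LinearOrder T]
    [DecidableEq I] [DecidableEq J]
    (a : I → K → ℝ) (d : J → K → T → ℝ)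
    (ha : ∀ i k, a i k = 0 ∨ a i k = 1)
    (hd : ∀ j k t, 0 ≤ d j k t)
    (S S' : Finset (I × J × T)) (hSS' : S ⊆ S')
    (v : I × J × T) (hv : v ∉ S') :
    coveredDemand a d (insert v S') - coveredDemand a d S'
      ≤ coveredDemand a d (insert v S) - coveredDemand a d S := by
  have ha₀ : ∀ i k, 0 ≤ a i k := fun i k => by rcases ha i k with h | h <;> simp [h]
  have ha₁ : ∀ i k, a i k ≤ 1 := fun i k => by rcases ha i k with h | h <;> simp [h]
  simp only [coveredDemand, ← Finset.sum_sub_distrib, ← mul_sub]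
  refine Finset.sum_le_sum fun j _ => Finset.sum_le_sum fun k _ => Finset.sum_le_sum fun t _ =>
    mul_le_mul_of_nonneg_left ?_ (hd j k t)
  change (1 - uncovered a j k t (insert v S')) - (1 - uncovered a j k t S')
    ≤ (1 - uncovered a j k t (insert v S)) - (1 - uncovered a j k t S)
  rw [uncovered_insert a j k t hv, uncovered_insert a j k t fun h => hv (hSS' h)]
  linarith [mul_le_mul_of_nonneg_left (uncovered_antitone ha₀ ha₁ j k t hSS')
    (sub_nonneg.2 (uncovered_le_one ha₀ ha₁ j k t {v}))]
end

section
/- Adding a truck that is dominated by a later truck on the same connection yields zero marginal gain: if S ⊆ I × J × T is a schedule and there exists a timeslot t' > t with (i,j,t') ∈ S, then g(S ∪ {(i,j,t)}) = g(S). -/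
open Finset

/-- **Dominated trucks give zero marginal gain.**
If the schedule `S` already contains a later truck `(i, j, t')` with `t' > t` on the same
connection, then adding the truck `(i, j, t)` does not change the covered demand. -/
theorem coveredDemand_insert_dominated
    {I J K T : Type*} [Fintype I] [Fintype J] [Fintype K] [Fintype T] [LinearOrder T]
    [DecidableEq I] [DecidableEq J]
    (a : I → K → ℝ) (d : J → K → T → ℝ)
    (ha : ∀ i k, a i k = 0 ∨ a i k = 1)
    (hd : ∀ j k t, 0 ≤ d j k t)
    (S : Finset (I × J × T)) (i : I) (j : J) (t t' : T)
    (htt' : t < t') (hmem : (i, j, t') ∈ S) :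
    coveredDemand a d (insert (i, j, t) S) = coveredDemand a d S := by
  unfold coveredDemand
  refine sum_congr rfl fun j₁ _ => sum_congr rfl fun k _ => sum_congr rfl fun t₁ _ => ?_
  congr 2
  refine prod_congr rfl fun i₁ _ => ?_
  rcases ha i₁ k with h | h
  · simp [h]
  by_cases hx : i₁ = i ∧ j₁ = j ∧ t₁ ≤ t
  · obtain ⟨rfl, rfl, ht⟩ := hx
    have ht' : t' ∈ univ.filter (fun τ => t₁ ≤ τ) := by simpa using ht.trans htt'.le
    rw [prod_eq_zero ht' (by simp [h, hmem]), prod_eq_zero ht' (by simp [h, hmem])]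
  · refine prod_congr rfl fun τ hτ => ?_
    have hne : (i₁, j₁, τ) ≠ (i, j, t) := by
      rintro ⟨⟩
      exact hx ⟨rfl, rfl, (mem_filter.mp hτ).2⟩
    simp only [mem_insert, hne, false_or]
end

section
/- A later truck on a connection covers at least as much demand as an earlier one: for any schedule S ⊆ I × J × T and any timeslots t ≤ t', it holds that g(S ∪ {(i,j,t)}) ≤ g(S ∪ {(i,j,t')}). (This justifies dropping the at-most-one-last-truck constraint without loss of optimality.) -/
open Finset

/-- If every truck in `S` is matched in `S'` by a truck on the same connection which is no earlier,
then `S'` covers at least as much demand as `S`. -/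
lemma coveredDemand_le_of_forall_exists_le
    {I J K T : Type*} [Fintype I] [Fintype J] [Fintype K] [Fintype T] [LinearOrder T]
    [DecidableEq I] [DecidableEq J]
    {a : I → K → ℝ} {d : J → K → T → ℝ}
    (ha : ∀ i k, a i k = 0 ∨ a i k = 1) (hd : ∀ j k t, 0 ≤ d j k t)
    {S S' : Finset (I × J × T)}
    (h : ∀ i j τ, (i, j, τ) ∈ S → ∃ τ', τ ≤ τ' ∧ (i, j, τ') ∈ S') :
    coveredDemand a d S ≤ coveredDemand a d S' := by
  have factor_mem (R : Finset (I × J × T)) (i : I) (j : J) (k : K) (τ : T) :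
      1 - a i k * (if (i, j, τ) ∈ R then (1 : ℝ) else 0) ∈ Set.Icc (0 : ℝ) 1 := by
    rcases ha i k with hik | hik <;> split_ifs <;> simp [hik]
  unfold coveredDemand
  refine sum_le_sum fun j _ => sum_le_sum fun k _ => sum_le_sum fun t _ =>
    mul_le_mul_of_nonneg_left (sub_le_sub_left ?_ 1) (hd j k t)
  by_cases hcov : ∃ i τ, t ≤ τ ∧ a i k = 1 ∧ (i, j, τ) ∈ S
  · obtain ⟨i, τ, hτ, hik, hS⟩ := hcov
    obtain ⟨τ', hτ', hS'⟩ := h i j τ hS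
    rw [prod_eq_zero (mem_univ i)
      (prod_eq_zero (mem_filter.2 ⟨mem_univ τ', hτ.trans hτ'⟩) (by simp [hik, hS']))]
    exact prod_nonneg fun i _ => prod_nonneg fun τ _ => (factor_mem S i j k τ).1
  · push Not at hcov
    have hS : ∏ i, ∏ τ ∈ univ.filter (fun τ => t ≤ τ),
        (1 - a i k * (if (i, j, τ) ∈ S then (1 : ℝ) else 0)) = 1 := by
      refine prod_eq_one fun i _ => prod_eq_one fun τ hτ => ?_
      rcases ha i k with hik | hik
      · simp [hik]
      · simp [hcov i τ (mem_filter.1 hτ).2 hik]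
    rw [hS]
    exact prod_le_one (fun i _ => prod_nonneg fun τ _ => (factor_mem S' i j k τ).1)
      fun i _ => prod_le_one (fun τ _ => (factor_mem S' i j k τ).1)
        fun τ _ => (factor_mem S' i j k τ).2

/-- **A later truck covers at least as much demand as an earlier one.**
For any schedule `S` and timeslots `t ≤ t'`, scheduling the last truck of connection
`(i,j)` at `t'` covers at least as much demand as scheduling it at `t`. -/
theorem coveredDemand_insert_mono_time
    {I J K T : Type*} [Fintype I] [Fintype J] [Fintype K] [Fintype T] [LinearOrder T]
    [DecidableEq I] [DecidableEq J]
    (a : I → K → ℝ) (d : J → K → T → ℝ)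
    (ha : ∀ i k, a i k = 0 ∨ a i k = 1)
    (hd : ∀ j k t, 0 ≤ d j k t)
    (S : Finset (I × J × T)) (i : I) (j : J) (t t' : T) (htt' : t ≤ t') :
    coveredDemand a d (insert (i, j, t) S) ≤ coveredDemand a d (insert (i, j, t') S) := by
  refine coveredDemand_le_of_forall_exists_le ha hd fun i₁ j₁ τ hτ => ?_
  rcases mem_insert.1 hτ with heq | hτ
  · obtain ⟨rfl, rfl, rfl⟩ : i₁ = i ∧ j₁ = j ∧ τ = t := by simpa using heq
    exact ⟨t', htt', mem_insert_self _ _⟩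
  · exact ⟨τ, le_rfl, mem_insert_of_mem hτ⟩
end

section
/- Rounding-gap lemma: suppose each delivery station j ∈ J is connected to a set I_j ⊆ I of fulfillment centers with |I_j| ≤ m for all j, where m ≥ 1, and X is a schedule matrix with entries x_{ijτ} ∈ [0,1] satisfying x_{ijτ} = 0 whenever i ∉ I_j. Then g(X) ≥ ρ(mT) · f(X), where ρ(x) = 1 − (1 − 1/x)^x and T = |T| is the number of timeslots. -/
open Finset

/-- The arithmetic-geometric mean inequality for `∏ (1 - y x)`, padded to `n` factors. -/
lemma prod_one_sub_le_one_sub_sum_div_pow {ι : Type*} (S : Finset ι) (y : ι → ℝ)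
    (hy : ∀ x ∈ S, y x ≤ 1) {n : ℕ} (hn : n ≠ 0) (hS : S.card ≤ n) :
    ∏ x ∈ S, (1 - y x) ≤ (1 - (∑ x ∈ S, y x) / n) ^ n := by
  have hn0 : (0 : ℝ) < n := by positivity
  have hSn : (S.card : ℝ) ≤ n := by exact_mod_cast hS
  have amgm := Real.geom_mean_le_arith_mean_weighted (Finset.insertNone S)
    (fun o => o.elim ((n - S.card : ℝ) / n) (fun _ => (1 / n : ℝ)))
    (fun o => o.elim 1 (fun x => 1 - y x))
    (by
      rintro (_ | x) _
      · exact div_nonneg (sub_nonneg.2 hSn) hn0.le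
      · exact one_div_nonneg.2 hn0.le)
    (by
      simp only [Finset.sum_insertNone, Option.elim, Finset.sum_const, nsmul_eq_mul]
      field_simp
      ring)
    (by
      rintro (_ | x) hx
      · exact zero_le_one
      · exact sub_nonneg.2 (hy x (by simpa using hx)))
  simp only [Finset.prod_insertNone, Finset.sum_insertNone, Option.elim, Real.one_rpow,
    one_mul, mul_one, ← Finset.mul_sum, Finset.sum_sub_distrib, Finset.sum_const,
    nsmul_eq_mul] at amgm
  have hpos : ∀ x ∈ S, 0 ≤ 1 - y x := fun x hx => sub_nonneg.2 (hy x hx)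
  rw [Real.finsetProd_rpow S _ hpos] at amgm
  have hP : 0 ≤ ∏ x ∈ S, (1 - y x) := Finset.prod_nonneg hpos
  calc ∏ x ∈ S, (1 - y x) = ((∏ x ∈ S, (1 - y x)) ^ (1 / n : ℝ)) ^ n := by
        rw [one_div, Real.rpow_inv_natCast_pow hP hn]
    _ ≤ _ := pow_le_pow_left₀ (Real.rpow_nonneg hP _) amgm n
    _ = _ := by
        congr 1
        field_simp
        ring

/-- The pointwise rounding bound: a union of at most `n` independent events with probabilities
`y x` has probability at least `1 - (1 - 1 / n) ^ n` times its truncated union bound. -/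
lemma mul_min_one_sum_le_one_sub_prod {ι : Type*} (S : Finset ι) (y : ι → ℝ)
    (hy : ∀ x ∈ S, y x ∈ Set.Icc (0 : ℝ) 1) {n : ℕ} (hn : n ≠ 0) (hS : S.card ≤ n) :
    (1 - (1 - 1 / (n : ℝ)) ^ n) * min 1 (∑ x ∈ S, y x) ≤ 1 - ∏ x ∈ S, (1 - y x) := by
  have hn1 : (1 : ℝ) ≤ n := by exact_mod_cast Nat.one_le_iff_ne_zero.2 hn
  have hn0 : (0 : ℝ) < n := by positivity
  have hSn : (S.card : ℝ) ≤ n := by exact_mod_cast hS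
  set s := ∑ x ∈ S, y x with hs
  have hs0 : 0 ≤ s := Finset.sum_nonneg fun x hx => (hy x hx).1
  have hsn : s ≤ n := by
    refine le_trans ?_ hSn
    simpa using Finset.sum_le_card_nsmul S y 1 fun x hx => (hy x hx).2
  have hprod := prod_one_sub_le_one_sub_sum_div_pow S y (fun x hx => (hy x hx).2) hn hS
  rw [← hs] at hprod
  set u := min 1 s with hu
  have hu0 : 0 ≤ u := le_min zero_le_one hs0
  have hu1 : u ≤ 1 := min_le_left _ _
  have hdiv : s / n ≤ 1 := (div_le_one hn0).2 hsn
  have hus : u / n ≤ s / n := by gcongr; exact min_le_right _ _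
  have hpow : (1 - s / n) ^ n ≤ (1 - u / n) ^ n :=
    pow_le_pow_left₀ (by linarith) (by linarith) n
  have hinv : 1 / (n : ℝ) ≤ 1 := (div_le_one hn0).2 hn1
  have hconv := (convexOn_pow (𝕜 := ℝ) n).2 (Set.mem_Ici.2 zero_le_one)
    (Set.mem_Ici.2 (sub_nonneg.2 hinv)) (sub_nonneg.2 hu1) hu0 (sub_add_cancel 1 u)
  simp only [smul_eq_mul, one_pow, mul_one] at hconv
  rw [show 1 - u + u * (1 - 1 / (n : ℝ)) = 1 - u / n by ring] at hconv
  linarith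

/-- **Rounding-gap lemma.**  Suppose each delivery station `j` is connected to a set
`Ij j ⊆ I` of at most `m ≥ 1` fulfillment centers, and the schedule matrix `X` has entries
in `[0,1]` vanishing outside the connections.  Then `g(X) ≥ ρ(mT) · f(X)`, where
`ρ(x) = 1 - (1 - 1/x)^x`, `T` is the number of timeslots,
`g(X) = Σ_{j,k,t} d j k t * (1 - Π_i Π_{τ ≥ t} (1 - a i k * X i j τ))` is the covered
demand and `f(X) = Σ_{j,k,t} d j k t * min 1 (Σ_i Σ_{τ ≥ t} a i k * X i j τ)` its
concave reformulation. -/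
theorem rounding_gap
    {I J K T : Type*} [Fintype I] [Fintype J] [Fintype K] [Fintype T] [LinearOrder T]
    (a : I → K → ℝ) (d : J → K → T → ℝ) (X : I → J → T → ℝ)
    (ha : ∀ i k, a i k = 0 ∨ a i k = 1)
    (hd : ∀ j k t, 0 ≤ d j k t)
    (hX : ∀ i j τ, X i j τ ∈ Set.Icc (0 : ℝ) 1)
    (m : ℕ) (hm : 1 ≤ m) (Ij : J → Finset I)
    (hcard : ∀ j, (Ij j).card ≤ m)
    (hzero : ∀ i j τ, i ∉ Ij j → X i j τ = 0) :
    (1 - (1 - 1 / ((m * Fintype.card T : ℕ) : ℝ)) ^ (m * Fintype.card T)) *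
        (∑ j, ∑ k, ∑ t, d j k t *
          min 1 (∑ i, ∑ τ ∈ Finset.univ.filter (fun τ => t ≤ τ), a i k * X i j τ))
      ≤
    ∑ j, ∑ k, ∑ t, d j k t *
        (1 - ∏ i, ∏ τ ∈ Finset.univ.filter (fun τ => t ≤ τ), (1 - a i k * X i j τ)) := by
  simp only [Finset.mul_sum]
  refine Finset.sum_le_sum fun j _ => Finset.sum_le_sum fun k _ => Finset.sum_le_sum fun t _ => ?_
  rw [mul_left_comm]
  refine mul_le_mul_of_nonneg_left ?_ (hd j k t)
  set F := Finset.univ.filter (fun τ => t ≤ τ)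
  have hsum : ∑ i, ∑ τ ∈ F, a i k * X i j τ = ∑ p ∈ Ij j ×ˢ F, a p.1 k * X p.1 j p.2 := by
    rw [Finset.sum_product]
    refine (Finset.sum_subset (Finset.subset_univ _) fun i _ hi => ?_).symm
    simp [hzero i j _ hi]
  have hprod : ∏ i, ∏ τ ∈ F, (1 - a i k * X i j τ)
      = ∏ p ∈ Ij j ×ˢ F, (1 - a p.1 k * X p.1 j p.2) := by
    rw [Finset.prod_product]
    refine (Finset.prod_subset (Finset.subset_univ _) fun i _ hi => ?_).symm
    simp [hzero i j _ hi]
  rw [hsum, hprod]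
  have hT : Fintype.card T ≠ 0 := (Fintype.card_pos_iff.2 ⟨t⟩).ne'
  refine mul_min_one_sum_le_one_sub_prod _ _ (fun p _ => ?_)
    (Nat.mul_ne_zero (Nat.one_le_iff_ne_zero.1 hm) hT) ?_
  · rcases ha p.1 k with h | h <;> simp only [h, zero_mul, one_mul]
    · exact ⟨le_rfl, zero_le_one⟩
    · exact hX _ _ _
  · rw [Finset.card_product]
    exact Nat.mul_le_mul (hcard j) (Finset.card_le_univ F)
end

section
/- Per-term rounding inequality: for any integer N ≥ 1 and any reals x₁, …, x_N ∈ [0,1], it holds that 1 − Π_{l=1}^N (1 − x_l) ≥ (1 − (1 − 1/N)^N) · min(1, Σ_{l=1}^N x_l). -/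
open Finset

/-- **AM-GM inequality** in power form: a product of nonnegative reals is at most the corresponding
power of their mean. -/
theorem prod_le_sum_div_card_pow {ι : Type*} (s : Finset ι) (z : ι → ℝ) (hs : s.Nonempty)
    (hz : ∀ i ∈ s, 0 ≤ z i) : ∏ i ∈ s, z i ≤ ((∑ i ∈ s, z i) / #s) ^ #s := by
  have hcard : (#s : ℝ) ≠ 0 := by exact_mod_cast hs.card_pos.ne'
  have h := Real.geom_mean_le_arith_mean_weighted s (fun _ => (#s : ℝ)⁻¹) z
    (fun _ _ => by positivity) (by simp [hcard]) hz
  rw [← Finset.mul_sum, Real.finsetProd_rpow s z hz] at h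
  calc ∏ i ∈ s, z i = ((∏ i ∈ s, z i) ^ (#s : ℝ)⁻¹) ^ #s :=
        (Real.rpow_inv_natCast_pow (prod_nonneg hz) hs.card_pos.ne').symm
    _ ≤ ((#s : ℝ)⁻¹ * ∑ i ∈ s, z i) ^ #s :=
        pow_le_pow_left₀ (Real.rpow_nonneg (prod_nonneg hz) _) h _
    _ = ((∑ i ∈ s, z i) / #s) ^ #s := by rw [inv_mul_eq_div]

/-- **Per-term rounding inequality.**  For any integer `N ≥ 1` and reals
`x₁, …, x_N ∈ [0,1]`,
`1 - Π_l (1 - x_l) ≥ (1 - (1 - 1/N)^N) · min 1 (Σ_l x_l)`. -/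
theorem per_term_rounding (N : ℕ) (hN : 1 ≤ N) (x : Fin N → ℝ)
    (hx : ∀ l, x l ∈ Set.Icc (0 : ℝ) 1) :
    (1 - (1 - 1 / (N : ℝ)) ^ N) * min 1 (∑ l, x l) ≤ 1 - ∏ l, (1 - x l) := by
  have : NeZero N := ⟨by omega⟩
  have hN1 : (1 : ℝ) ≤ N := by exact_mod_cast hN
  have hN0 : (N : ℝ) ≠ 0 := by positivity
  have hnonneg : ∀ l ∈ univ, 0 ≤ 1 - x l := fun l _ => sub_nonneg.2 (hx l).2
  have hprod := prod_le_sum_div_card_pow univ (fun l => 1 - x l) univ_nonempty hnonneg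
  have hsum := sum_nonneg hnonneg
  simp only [sum_sub_distrib, sum_const, card_univ, Fintype.card_fin, nsmul_eq_mul, mul_one]
    at hprod hsum
  set m := min 1 (∑ l, x l)
  have hm0 : 0 ≤ m := le_min zero_le_one (sum_nonneg fun l _ => (hx l).1)
  have hm1 : m ≤ 1 := min_le_left _ _
  have hmean : ((N - ∑ l, x l) / N) ^ N ≤ ((N - m) / N) ^ N := by
    gcongr
    exact min_le_right _ _
  have hconv := (convexOn_pow N).2 (x := (1 : ℝ)) (Set.mem_Ici.2 zero_le_one)
    (y := 1 - 1 / (N : ℝ)) (Set.mem_Ici.2 (sub_nonneg.2 ((div_le_one (by positivity)).2 hN1)))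
    (sub_nonneg.2 hm1) hm0 (sub_add_cancel 1 m)
  have hcomb : (1 - m) • (1 : ℝ) + m • (1 - 1 / (N : ℝ)) = (N - m) / N := by
    simp only [smul_eq_mul]
    field_simp
    ring
  rw [hcomb] at hconv
  simp only [one_pow, smul_eq_mul] at hconv
  linarith
end

section
/- Convexity along inbound pipage directions: let X be a schedule matrix with all entries in [0,1], and let Z be the direction matrix supported on two coordinates with the same destination j: Z_{i₁ j t₁} = 1, Z_{i₂ j t₂} = −1 (with i₁ ≠ i₂), and Z zero elsewhere. Then the function γ ↦ g(X + γZ) is a convex function of γ on ℝ (for each term of g it is a quadratic in γ with nonnegative leading coefficient). -/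
open Finset

/-- A finite sum of convex functions is convex. -/
theorem convexOn_univ_sum {ι : Type*} [Fintype ι] {f : ι → ℝ → ℝ}
    (hf : ∀ i, ConvexOn ℝ Set.univ (f i)) : ConvexOn ℝ Set.univ (fun γ => ∑ i, f i γ) := by
  refine ⟨convex_univ, fun x _ y _ r s hr hs hrs => ?_⟩
  simp only [smul_sum, ← sum_add_distrib]
  exact sum_le_sum fun i _ => (hf i).2 (Set.mem_univ x) (Set.mem_univ y) hr hs hrs

/-- A product of real affine functions with nonnegative constant terms is concave when only two
of them are nonconstant and these have slopes of opposite sign. -/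
theorem concaveOn_prod_affine_of_slopes {ι : Type*} [Fintype ι] (u v : ι → ℝ) {p q : ι}
    (hpq : p ≠ q) (hu : ∀ i, 0 ≤ u i) (hv : ∀ i, i ≠ p → i ≠ q → v i = 0)
    (hp : v p ≤ 0) (hq : 0 ≤ v q) :
    ConcaveOn ℝ Set.univ (fun γ : ℝ => ∏ i, (u i + γ * v i)) := by
  classical
  set c : ℝ := ∏ i ∈ (univ.erase p).erase q, u i with hc_def
  have hc : 0 ≤ c := prod_nonneg fun i _ => hu i
  have hprod (γ : ℝ) : ∏ i, (u i + γ * v i) = (u p + γ * v p) * ((u q + γ * v q) * c) := by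
    rw [← mul_prod_erase univ _ (mem_univ p),
      ← mul_prod_erase (univ.erase p) _ (mem_erase.2 ⟨hpq.symm, mem_univ q⟩), hc_def]
    congr 2
    refine prod_congr rfl fun i hi => ?_
    simp only [mem_erase, mem_univ, and_true] at hi
    rw [hv i hi.2 hi.1, mul_zero, add_zero]
  simp only [hprod]
  refine ⟨convex_univ, fun x _ y _ r s hr hs hrs => ?_⟩
  obtain rfl : s = 1 - r := by linarith
  have key : 0 ≤ -v p * v q * c * (r * (1 - r)) * (x - y) ^ 2 := by
    have := neg_nonneg.2 hp
    positivity
  simp only [smul_eq_mul]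
  linear_combination key

/-- **Convexity along inbound pipage directions.**
Let `X` be a schedule matrix with entries in `[0,1]` and let `Z` be the direction matrix
supported on two coordinates with the same destination `j₀`: `Z i₁ j₀ t₁ = 1`,
`Z i₂ j₀ t₂ = -1` with `i₁ ≠ i₂`, and `Z` zero elsewhere.  Then `γ ↦ g(X + γZ)` is a
convex function of `γ` on `ℝ`, where
`g(X) = Σ_{j,k,t} d j k t * (1 - Π_i Π_{τ ≥ t} (1 - a i k * X i j τ))`. -/
theorem convex_along_inbound_pipage_direction
    {I J K T : Type*} [Fintype I] [Fintype J] [Fintype K] [Fintype T] [LinearOrder T]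
    (a : I → K → ℝ) (d : J → K → T → ℝ) (X : I → J → T → ℝ)
    (ha : ∀ i k, a i k = 0 ∨ a i k = 1)
    (hd : ∀ j k t, 0 ≤ d j k t)
    (hX : ∀ i j τ, X i j τ ∈ Set.Icc (0 : ℝ) 1)
    (i₁ i₂ : I) (hne : i₁ ≠ i₂) (j₀ : J) (t₁ t₂ : T) (Z : I → J → T → ℝ)
    (hZ1 : Z i₁ j₀ t₁ = 1) (hZ2 : Z i₂ j₀ t₂ = -1)
    (hZ0 : ∀ i j τ, (i, j, τ) ≠ (i₁, j₀, t₁) → (i, j, τ) ≠ (i₂, j₀, t₂) → Z i j τ = 0) :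
    ConvexOn ℝ Set.univ (fun γ : ℝ =>
      ∑ j, ∑ k, ∑ t, d j k t *
        (1 - ∏ i, ∏ τ ∈ Finset.univ.filter (fun τ => t ≤ τ),
          (1 - a i k * (X i j τ + γ * Z i j τ)))) := by
  classical
  refine convexOn_univ_sum fun j => convexOn_univ_sum fun k => convexOn_univ_sum fun t => ?_
  have ha0 (i : I) : 0 ≤ a i k := by rcases ha i k with h | h <;> simp [h]
  have ha1 (i : I) : a i k ≤ 1 := by rcases ha i k with h | h <;> simp [h]
  have hZp : 0 ≤ Z i₁ j t₁ := by
    by_cases hj : j = j₀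
    · simp [hj, hZ1]
    · rw [hZ0 i₁ j t₁ (by simp [hj]) (by simp [hj])]
  have hZq : Z i₂ j t₂ ≤ 0 := by
    by_cases hj : j = j₀
    · simp [hj, hZ2]
    · rw [hZ0 i₂ j t₂ (by simp [hj]) (by simp [hj])]
  have hconcave := concaveOn_prod_affine_of_slopes
    (fun p : I × T => if t ≤ p.2 then 1 - a p.1 k * X p.1 j p.2 else 1)
    (fun p : I × T => if t ≤ p.2 then -(a p.1 k * Z p.1 j p.2) else 0)
    (p := (i₁, t₁)) (q := (i₂, t₂)) (by simp [hne])
    (fun p => by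
      split_ifs
      · exact sub_nonneg.2 (mul_le_one₀ (ha1 _) (hX _ _ _).1 (hX _ _ _).2)
      · exact zero_le_one)
    (fun p hp hq => by
      have hZ : Z p.1 j p.2 = 0 := hZ0 _ _ _
        (fun h => hp (by simp_all [Prod.ext_iff])) (fun h => hq (by simp_all [Prod.ext_iff]))
      simp [hZ])
    (by
      dsimp only
      split_ifs
      · exact neg_nonpos.2 (mul_nonneg (ha0 _) hZp)
      · exact le_rfl)
    (by
      dsimp only
      split_ifs
      · exact neg_nonneg.2 (mul_nonpos_of_nonneg_of_nonpos (ha0 _) hZq)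
      · exact le_rfl)
  refine (((convexOn_const (1 : ℝ) convex_univ).sub hconcave).smul (hd j k t)).congr fun γ _ => ?_
  simp only [Pi.sub_apply, smul_eq_mul, Fintype.prod_prod_type, prod_filter]
  congr 2
  refine prod_congr rfl fun i _ => prod_congr rfl fun τ _ => ?_
  split_ifs <;> ring
end

section
/- Affinity along outbound pipage directions: let X be any schedule matrix, and let Z be the direction matrix supported on two coordinates with the same origin i and the same timeslot t but different destinations: Z_{i j₁ t} = 1, Z_{i j₂ t} = −1 with j₁ ≠ j₂, and Z zero elsewhere. Then the function γ ↦ g(X + γZ) is an affine function of γ (there exist constants β and c with g(X + γZ) = βγ + c for all γ ∈ ℝ); in particular it is convex. -/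
open Finset

/-- A finite sum of affine functions of a real variable is affine. -/
theorem exists_affine_sum {ι : Type*} (s : Finset ι) (f : ι → ℝ → ℝ)
    (hf : ∀ i, ∃ β c : ℝ, ∀ γ, f i γ = β * γ + c) :
    ∃ β c : ℝ, ∀ γ, ∑ i ∈ s, f i γ = β * γ + c := by
  choose β c h using hf
  exact ⟨∑ i ∈ s, β i, ∑ i ∈ s, c i, fun γ => by
    simp only [h, Finset.sum_add_distrib, Finset.sum_mul]⟩

/-- A finite product of functions of a real variable, one of which is affine and the others
constant, is affine. -/
theorem exists_affine_prod {ι : Type*} (s : Finset ι) (f : ι → ℝ → ℝ) (i₀ : ι)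
    (h₀ : ∃ β c : ℝ, ∀ γ, f i₀ γ = β * γ + c)
    (hf : ∀ i, i ≠ i₀ → ∀ γ, f i γ = f i 0) :
    ∃ β c : ℝ, ∀ γ, ∏ i ∈ s, f i γ = β * γ + c := by
  classical
  by_cases hi : i₀ ∈ s
  · obtain ⟨β, c, h⟩ := h₀
    refine ⟨β * ∏ i ∈ s.erase i₀, f i 0, c * ∏ i ∈ s.erase i₀, f i 0, fun γ => ?_⟩
    rw [← Finset.mul_prod_erase s _ hi, h,
      Finset.prod_congr rfl fun i hi' => hf i (Finset.ne_of_mem_erase hi') γ]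
    ring
  · refine ⟨0, ∏ i ∈ s, f i 0, fun γ => ?_⟩
    rw [Finset.prod_congr rfl fun i hi' => hf i (ne_of_mem_of_not_mem hi' hi) γ]
    ring

/-- **Affinity along outbound pipage directions.**
Let `X` be any schedule matrix and let `Z` be the direction matrix supported on two
coordinates with the same origin `i₀` and the same timeslot `t₀` but different
destinations: `Z i₀ j₁ t₀ = 1`, `Z i₀ j₂ t₀ = -1` with `j₁ ≠ j₂`, and `Z` zero elsewhere.
Then `γ ↦ g(X + γZ)` is an affine function of `γ`; in particular it is convex.  Here
`g(X) = Σ_{j,k,t} d j k t * (1 - Π_i Π_{τ ≥ t} (1 - a i k * X i j τ))`. -/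
theorem affine_along_outbound_pipage_direction
    {I J K T : Type*} [Fintype I] [Fintype J] [Fintype K] [Fintype T] [LinearOrder T]
    (a : I → K → ℝ) (d : J → K → T → ℝ) (X : I → J → T → ℝ)
    (ha : ∀ i k, a i k = 0 ∨ a i k = 1)
    (hd : ∀ j k t, 0 ≤ d j k t)
    (i₀ : I) (j₁ j₂ : J) (hne : j₁ ≠ j₂) (t₀ : T) (Z : I → J → T → ℝ)
    (hZ1 : Z i₀ j₁ t₀ = 1) (hZ2 : Z i₀ j₂ t₀ = -1)
    (hZ0 : ∀ i j τ, (i, j, τ) ≠ (i₀, j₁, t₀) → (i, j, τ) ≠ (i₀, j₂, t₀) → Z i j τ = 0) :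
    (∃ β c : ℝ, ∀ γ : ℝ,
      (∑ j, ∑ k, ∑ t, d j k t *
        (1 - ∏ i, ∏ τ ∈ Finset.univ.filter (fun τ => t ≤ τ),
          (1 - a i k * (X i j τ + γ * Z i j τ)))) = β * γ + c) ∧
    ConvexOn ℝ Set.univ (fun γ : ℝ =>
      ∑ j, ∑ k, ∑ t, d j k t *
        (1 - ∏ i, ∏ τ ∈ Finset.univ.filter (fun τ => t ≤ τ),
          (1 - a i k * (X i j τ + γ * Z i j τ)))) := by
  have key : ∃ β c : ℝ, ∀ γ : ℝ,
      (∑ j, ∑ k, ∑ t, d j k t *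
        (1 - ∏ i, ∏ τ ∈ Finset.univ.filter (fun τ => t ≤ τ),
          (1 - a i k * (X i j τ + γ * Z i j τ)))) = β * γ + c := by
    refine exists_affine_sum _ _ fun j => exists_affine_sum _ _ fun k =>
      exists_affine_sum _ _ fun t => ?_
    have hZ : ∀ i τ, i ≠ i₀ ∨ τ ≠ t₀ → Z i j τ = 0 := by
      intro i τ h
      apply hZ0 <;> simp only [ne_eq, Prod.mk.injEq] <;> tauto
    obtain ⟨β, c, h⟩ := exists_affine_prod Finset.univ
      (fun i γ => ∏ τ ∈ Finset.univ.filter (fun τ => t ≤ τ),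
        (1 - a i k * (X i j τ + γ * Z i j τ))) i₀
      (exists_affine_prod _ (fun τ γ => 1 - a i₀ k * (X i₀ j τ + γ * Z i₀ j τ)) t₀
        ⟨-(a i₀ k * Z i₀ j t₀), 1 - a i₀ k * X i₀ j t₀, fun γ => by ring⟩
        fun τ hτ γ => by simp [hZ i₀ τ (Or.inr hτ)])
      fun i hi γ => by simp [hZ i _ (Or.inl hi)]
    exact ⟨-(d j k t * β), d j k t * (1 - c), fun γ => by rw [h]; ring⟩
  refine ⟨key, ?_⟩
  obtain ⟨β, c, h⟩ := key
  simp only [h]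
  exact ((LinearMap.mulLeft ℝ β).convexOn convex_univ).add_const c
end
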